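/- arXiv:1304.7075 — 3 statements merged into one kernel-verified Lean document; each statement's English description precedes it below -/
import Mathlib

section
/- There exist a constant c > 0 and an integer k₀ such that for all k ≥ k₀ and all positive integers n, if there exists a k×n Münchhausen matrix, then 3^k − n ≥ c·log k. -/
/-- A weighing matrix has all entries in `{-1, 0, 1}`. -/
def IsWeighing {k n : ℕ} (M : Matrix (Fin k) (Fin n) ℤ) : Prop :=
  ∀ i j, M i j = -1 ∨ M i j = 0 ∨ M i j = 1

/-- The vector of coin weights `(1, 2, …, n)`. -/
def coinVec (n : ℕ) : Fin n → ℤ := fun j => (j : ℤ) + 1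

/-- The componentwise sign of `M · v` where `v = (1, …, n)`. -/
def wvec {k n : ℕ} (M : Matrix (Fin k) (Fin n) ℤ) : Fin k → ℤ :=
  fun i => Int.sign (Matrix.mulVec M (coinVec n) i)

/-- `M` is Münchhausen: a weighing matrix such that for every permutation matrix `π`,
`w(M·π) = w(M)` implies `π = I`. -/
def IsMunchhausen {k n : ℕ} (M : Matrix (Fin k) (Fin n) ℤ) : Prop :=
  IsWeighing M ∧
    ∀ π : Equiv.Perm (Fin n), wvec (M * π.permMatrix ℤ) = wvec M → π = 1

/-- `M` with its rows permuted according to `σ`. -/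
def rowPerm {k n : ℕ} (σ : Equiv.Perm (Fin k)) (M : Matrix (Fin k) (Fin n) ℤ) :
    Matrix (Fin k) (Fin n) ℤ :=
  Matrix.submatrix M σ id

/-- The Baron's omni-sequence: the least `k` for which a `k × n` Münchhausen matrix exists. -/
noncomputable def B (n : ℕ) : ℕ :=
  sInf {k : ℕ | ∃ M : Matrix (Fin k) (Fin n) ℤ, IsMunchhausen M}

/-- The columns allowed in a weighing matrix with `k` rows: all vectors with entries in
`{-1, 0, 1}`. -/
def ternaryVectors (k : ℕ) : Finset (Fin k → ℤ) :=
  Fintype.piFinset fun _ => {-1, 0, 1}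

theorem mem_ternaryVectors {k : ℕ} {x : Fin k → ℤ} :
    x ∈ ternaryVectors k ↔ ∀ i, x i = -1 ∨ x i = 0 ∨ x i = 1 := by
  simp [ternaryVectors, Fintype.mem_piFinset]

theorem card_ternaryVectors (k : ℕ) : (ternaryVectors k).card = 3 ^ k := by
  simp [ternaryVectors, Fintype.card_piFinset]

/-- A column permutation acting on `M` as a row permutation that preserves `wvec M`
does not change the outcome of the weighings. -/
theorem wvec_mul_permMatrix_eq {k n : ℕ} {M : Matrix (Fin k) (Fin n) ℤ}
    {σ : Equiv.Perm (Fin k)} {π : Equiv.Perm (Fin n)}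
    (hσ : ∀ i, wvec M (σ i) = wvec M i) (hπ : ∀ i j, M i (π j) = M (σ i) j) :
    wvec (M * (π⁻¹).permMatrix ℤ) = wvec M := by
  have hM : M * (π⁻¹).permMatrix ℤ = M.submatrix σ id := by
    ext i j
    rw [Equiv.Perm.permMatrix, PEquiv.mul_toMatrix_toPEquiv]
    exact hπ i j
  rw [hM]
  funext i
  exact hσ i

theorem IsMunchhausen.eq_one_of_column_action {k n : ℕ} {M : Matrix (Fin k) (Fin n) ℤ}
    (hM : IsMunchhausen M) {σ : Equiv.Perm (Fin k)} {π : Equiv.Perm (Fin n)}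
    (hσ : ∀ i, wvec M (σ i) = wvec M i) (hπ : ∀ i j, M i (π j) = M (σ i) j) : π = 1 :=
  inv_eq_one.mp (hM.2 π⁻¹ (wvec_mul_permMatrix_eq hσ hπ))

/-- The columns of a Münchhausen matrix are pairwise distinct. -/
theorem IsMunchhausen.transpose_injective {k n : ℕ} {M : Matrix (Fin k) (Fin n) ℤ}
    (hM : IsMunchhausen M) : Function.Injective M.transpose := by
  intro a b hab
  have hab' : ∀ i, M i a = M i b := fun i => congrFun hab i
  refine Equiv.swap_eq_one_iff.mp
    (hM.eq_one_of_column_action (σ := 1) (fun _ => rfl) fun i j => ?_)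
  rw [Equiv.swap_apply_def]
  split_ifs with h₁ h₂ <;> simp_all

/-- The vectors with entries in `{-1, 0, 1}` that are not columns of `M`. -/
def missingColumns {k n : ℕ} (M : Matrix (Fin k) (Fin n) ℤ) : Finset (Fin k → ℤ) :=
  ternaryVectors k \ Finset.univ.image M.transpose

theorem IsMunchhausen.card_missingColumns_add {k n : ℕ} {M : Matrix (Fin k) (Fin n) ℤ}
    (hM : IsMunchhausen M) : (missingColumns M).card + n = 3 ^ k := by
  have hsub : Finset.univ.image M.transpose ⊆ ternaryVectors k := by
    intro x hx
    obtain ⟨j, -, rfl⟩ := Finset.mem_image.mp hx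
    exact mem_ternaryVectors.mpr fun i => hM.1 i j
  have h := Finset.card_sdiff_add_card_eq_card hsub
  rwa [Finset.card_image_of_injective _ hM.transpose_injective, Finset.card_univ,
    Fintype.card_fin, card_ternaryVectors] at h

/-- Two rows of a Münchhausen matrix with the same outcome are separated by a missing column. -/
theorem IsMunchhausen.exists_missingColumn_ne {k n : ℕ} {M : Matrix (Fin k) (Fin n) ℤ}
    (hM : IsMunchhausen M) {a b : Fin k} (hab : a ≠ b) (hw : wvec M a = wvec M b) :
    ∃ s ∈ missingColumns M, s a ≠ s b := by
  by_contra! hS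
  have hcol : ∀ x ∈ ternaryVectors k, x a ≠ x b → ∃ j, M.transpose j = x := by
    intro x hx hne
    by_contra hj
    refine hne (hS x (Finset.mem_sdiff.mpr ⟨hx, fun hmem => hj ?_⟩))
    obtain ⟨j, -, h⟩ := Finset.mem_image.mp hmem
    exact ⟨j, h⟩
  have himage : ∀ j, ∃ j', ∀ i, M i j' = M (Equiv.swap a b i) j := by
    intro j
    by_cases hj : M a j = M b j
    · refine ⟨j, fun i => ?_⟩
      rw [Equiv.swap_apply_def]
      split_ifs <;> simp_all
    · obtain ⟨j', hj'⟩ := hcol (fun i => M (Equiv.swap a b i) j)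
        (mem_ternaryVectors.mpr fun i => hM.1 _ j) (by simpa using Ne.symm hj)
      exact ⟨j', fun i => congrFun hj' i⟩
  choose f hf using himage
  have hinj : Function.Injective f := by
    intro j j' h
    apply hM.transpose_injective
    funext i
    have h₁ := hf j (Equiv.swap a b i)
    have h₂ := hf j' (Equiv.swap a b i)
    rw [Equiv.swap_apply_self] at h₁ h₂
    exact h₁.symm.trans (h ▸ h₂)
  have hone : Equiv.ofBijective f hinj.bijective_of_finite = 1 := by
    refine hM.eq_one_of_column_action (σ := Equiv.swap a b) (fun i => ?_) fun i j => hf j i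
    rw [Equiv.swap_apply_def]
    split_ifs <;> simp_all
  obtain ⟨j, hj⟩ := hcol (Pi.single a 1)
    (mem_ternaryVectors.mpr fun i => by by_cases h : i = a <;> simp [h])
    (by simp [hab.symm])
  have hfj : f j = j := congrArg (fun π : Equiv.Perm (Fin n) => π j) hone
  have ha := hf j a
  rw [hfj, Equiv.swap_apply_left] at ha
  have h₁ : M a j = 1 := by simpa using congrFun hj a
  have h₂ : M b j = 0 := by simpa [hab.symm] using congrFun hj b
  omega

theorem IsMunchhausen.le_three_pow {k n : ℕ} {M : Matrix (Fin k) (Fin n) ℤ}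
    (hM : IsMunchhausen M) : k ≤ 3 ^ ((missingColumns M).card + 1) := by
  by_contra! hlt
  let g : Fin k → Option (missingColumns M) → ℤ := fun i o => o.elim (wvec M i) fun s => s.1 i
  let T : Finset (Option (missingColumns M) → ℤ) := Fintype.piFinset fun _ => {-1, 0, 1}
  have hmaps : ∀ i ∈ (Finset.univ : Finset (Fin k)), g i ∈ T := by
    intro i _
    refine Fintype.mem_piFinset.mpr fun o => ?_
    cases o with
    | none =>
      rcases Int.sign_trichotomy (M.mulVec (coinVec n) i) with h | h | h <;>
        simp [g, wvec, h]
    | some s =>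
      simpa [g] using mem_ternaryVectors.mp (Finset.mem_sdiff.mp s.2).1 i
  have hcard : T.card < (Finset.univ : Finset (Fin k)).card := by
    simpa [T, Fintype.card_piFinset] using hlt
  obtain ⟨a, -, b, -, hab, hg⟩ := Finset.exists_ne_map_eq_of_card_lt_of_maps_to hcard hmaps
  obtain ⟨s, hs, hne⟩ := hM.exists_missingColumn_ne hab (congrFun hg none)
  exact hne (congrFun hg (some ⟨s, hs⟩))

/-- There are `c > 0` and `k₀` such that for all `k ≥ k₀` and positive `n`, the existence
of a `k × n` Münchhausen matrix implies `3^k − n ≥ c · log k`. -/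
theorem gap_lower_bound :
    ∃ c : ℝ, 0 < c ∧ ∃ k₀ : ℕ, ∀ k : ℕ, k₀ ≤ k → ∀ n : ℕ, 0 < n →
      (∃ M : Matrix (Fin k) (Fin n) ℤ, IsMunchhausen M) →
        c * Real.log k ≤ (3 : ℝ) ^ k - (n : ℝ) := by
  have hlog3 : 0 < Real.log 3 := Real.log_pos (by norm_num)
  refine ⟨1 / (2 * Real.log 3), by positivity, 9, ?_⟩
  rintro k hk n - ⟨M, hM⟩
  have hgap : (3 : ℝ) ^ k - n = (missingColumns M).card := by
    rw [sub_eq_iff_eq_add]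
    exact_mod_cast hM.card_missingColumns_add.symm
  rw [hgap]
  set m := (missingColumns M).card
  have hk9 : (9 : ℝ) ≤ k := by exact_mod_cast hk
  have hupper : Real.log k ≤ (m + 1) * Real.log 3 := by
    have h : (k : ℝ) ≤ 3 ^ (m + 1) := by exact_mod_cast hM.le_three_pow
    calc Real.log k ≤ Real.log (3 ^ (m + 1)) := Real.log_le_log (by linarith) h
      _ = (m + 1) * Real.log 3 := by rw [Real.log_pow]; push_cast; rfl
  have hlower : 2 * Real.log 3 ≤ Real.log k := by
    calc 2 * Real.log 3 = Real.log (3 ^ 2) := by rw [Real.log_pow]; norm_num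
      _ ≤ Real.log k := Real.log_le_log (by norm_num) (by linarith)
  rw [one_div_mul_eq_div, div_le_iff₀ (by positivity)]
  linarith
end

section
/- There are infinitely many positive integers n for which B(n) ≠ ⌈log₃ n⌉ (equivalently, B(n) > ⌈log₃ n⌉ for infinitely many n). -/
open Finset

/-- The signed total weight of the `i`-th weighing. -/
def rowWeight {k n : ℕ} (M : Matrix (Fin k) (Fin n) ℤ) (i : Fin k) : ℤ :=
  ∑ j, M i j * ((j : ℤ) + 1)

lemma wvec_eq_sign_rowWeight {k n : ℕ} (M : Matrix (Fin k) (Fin n) ℤ) (i : Fin k) :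
    wvec M i = (rowWeight M i).sign := rfl

lemma wvec_mul_permMatrix {k n : ℕ} (M : Matrix (Fin k) (Fin n) ℤ)
    (π : Equiv.Perm (Fin n)) (i : Fin k) :
    wvec (M * π.permMatrix ℤ) i = (∑ j, M i j * ((π j : ℤ) + 1)).sign := by
  rw [wvec_eq_sign_rowWeight, rowWeight, ← Equiv.sum_comp π]
  simp [Matrix.mul_apply, Equiv.Perm.permMatrix, PEquiv.toMatrix_apply]

lemma IsMunchhausen.eq_one {k n : ℕ} {M : Matrix (Fin k) (Fin n) ℤ} (hM : IsMunchhausen M)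
    (π : Equiv.Perm (Fin n))
    (h : ∀ i, (∑ j, M i j * ((π j : ℤ) + 1)).sign = (rowWeight M i).sign) : π = 1 :=
  hM.2 π <| funext fun i => by rw [wvec_mul_permMatrix, h, wvec_eq_sign_rowWeight]

lemma sum_mul_swap {k n : ℕ} (M : Matrix (Fin k) (Fin n) ℤ) (a b : Fin n) (i : Fin k) :
    ∑ j, M i j * ((Equiv.swap a b j : ℤ) + 1) =
      rowWeight M i + (M i a - M i b) * ((b : ℤ) - a) := by
  rcases eq_or_ne a b with rfl | hab
  · simp [rowWeight]
  have key : ∑ j, (M i j * ((Equiv.swap a b j : ℤ) + 1) - M i j * ((j : ℤ) + 1)) =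
      M i a * ((b : ℤ) - a) + M i b * ((a : ℤ) - b) := by
    rw [Fintype.sum_eq_add a b hab]
    · simp only [Equiv.swap_apply_left, Equiv.swap_apply_right]
      ring
    · rintro j ⟨hja, hjb⟩
      rw [Equiv.swap_apply_of_ne_of_ne hja hjb, sub_self]
  rw [Finset.sum_sub_distrib] at key
  rw [rowWeight]
  linarith

lemma IsMunchhausen.eq_of_swap {k n : ℕ} {M : Matrix (Fin k) (Fin n) ℤ} (hM : IsMunchhausen M)
    (a b : Fin n)
    (h : ∀ i, (rowWeight M i + (M i a - M i b) * ((b : ℤ) - a)).sign = (rowWeight M i).sign) :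
    a = b := by
  have := hM.eq_one (Equiv.swap a b) fun i => by rw [sum_mul_swap, h]
  exact Equiv.swap_eq_one_iff.1 this

lemma IsMunchhausen.column_injective {k n : ℕ} {M : Matrix (Fin k) (Fin n) ℤ}
    (hM : IsMunchhausen M) {a b : Fin n} (h : ∀ i, M i a = M i b) : a = b :=
  hM.eq_of_swap a b fun i => by simp [h i]

lemma IsWeighing.coe_sign {k n : ℕ} {M : Matrix (Fin k) (Fin n) ℤ} (hM : IsWeighing M)
    (i : Fin k) (j : Fin n) : ((SignType.sign (M i j) : SignType) : ℤ) = M i j := by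
  rcases hM i j with h | h | h <;> simp [h]

/-- With `3 ^ k` coins, every sign vector occurs as a column exactly once. -/
lemma IsMunchhausen.column_bijective {k n : ℕ} (hn : n = 3 ^ k)
    {M : Matrix (Fin k) (Fin n) ℤ} (hM : IsMunchhausen M) :
    Function.Bijective fun (j : Fin n) (i : Fin k) => SignType.sign (M i j) := by
  refine (Fintype.bijective_iff_injective_and_card _).2 ⟨fun a b hab => ?_, ?_⟩
  · refine hM.column_injective fun i => ?_
    rw [← hM.1.coe_sign i a, ← hM.1.coe_sign i b]
    exact congrArg _ (congrFun hab i)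
  · have h3 : Fintype.card SignType = 3 := rfl
    simp [hn, h3]

lemma IsMunchhausen.exists_flip {k n : ℕ} (hn : n = 3 ^ k) {M : Matrix (Fin k) (Fin n) ℤ}
    (hM : IsMunchhausen M) (i : Fin k) :
    ∃ φ : Equiv.Perm (Fin n), (∀ j, φ (φ j) = j) ∧ (∀ j, M i (φ j) = -M i j) ∧
      ∀ i' ≠ i, ∀ j, M i' (φ j) = M i' j := by
  have hex : ∀ j, ∃ j', M i j' = -M i j ∧ ∀ i' ≠ i, M i' j' = M i' j := by
    intro j
    obtain ⟨j', hj'⟩ := (hM.column_bijective hn).2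
      (Function.update (fun i => SignType.sign (M i j)) i (-SignType.sign (M i j)))
    refine ⟨j', ?_, fun i' hi' => ?_⟩
    · have := congrFun hj' i
      simp only [Function.update_self] at this
      rw [← hM.1.coe_sign i j', this, SignType.coe_neg, hM.1.coe_sign]
    · have := congrFun hj' i'
      simp only [Function.update_of_ne hi'] at this
      rw [← hM.1.coe_sign i' j', this, hM.1.coe_sign]
  choose φ hφ hφ' using hex
  have hinv : Function.Involutive φ := fun j => hM.column_injective fun i' => by
    rcases eq_or_ne i' i with rfl | hi'
    · rw [hφ, hφ, neg_neg]
    · rw [hφ' _ _ hi', hφ' _ _ hi']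
  exact ⟨hinv.toPerm φ, hinv, hφ, fun i' hi' j => hφ' j i' hi'⟩

lemma IsMunchhausen.card_ne_zero {k n : ℕ} (hn : n = 3 ^ k) {M : Matrix (Fin k) (Fin n) ℤ}
    (hM : IsMunchhausen M) (i : Fin k) :
    #{j | M i j ≠ 0} = 2 * 3 ^ (k - 1) := by
  have h : #{j | M i j ≠ 0} = #{c : Fin k → SignType | c i ≠ 0} := by
    refine Finset.card_bijective _ (hM.column_bijective hn) fun j => ?_
    simp
  have h' : ({c : Fin k → SignType | c i ≠ 0} : Finset _) =
      Fintype.piFinset (Function.update (fun _ => univ) i {-1, 1}) := by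
    ext c
    simp only [mem_filter, mem_univ, true_and, Fintype.mem_piFinset]
    constructor
    · intro hc i'
      rcases eq_or_ne i' i with rfl | hi'
      · rw [Function.update_self]
        revert hc
        generalize c i' = t
        revert t
        decide
      · simp [Function.update_of_ne hi']
    · intro hc
      have := hc i
      rw [Function.update_self] at this
      revert this
      generalize c i = t
      revert t
      decide
  have h3 : Fintype.card SignType = 3 := rfl
  rw [h, h', Fintype.card_piFinset, ← Finset.mul_prod_erase _ _ (mem_univ i),
    Function.update_self, Finset.prod_congr rfl (g := fun _ => 3)]
  · simp
  · intro i' hi'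
    rw [Function.update_of_ne (ne_of_mem_erase hi'), Finset.card_univ, h3]

lemma Int.sign_add_of_mul_nonneg {s t : ℤ} (hs : s ≠ 0) (h : 0 ≤ t * s) :
    (s + t).sign = s.sign := by
  rcases hs.lt_or_gt with hs | hs
  · have : t ≤ 0 := by nlinarith
    rw [Int.sign_eq_neg_one_of_neg hs, Int.sign_eq_neg_one_of_neg (by omega)]
  · have : 0 ≤ t := by nlinarith
    rw [Int.sign_eq_one_of_pos hs, Int.sign_eq_one_of_pos (by omega)]

lemma Int.sign_add_of_abs_lt {s t : ℤ} (h : |t| < |s|) : (s + t).sign = s.sign := by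
  rcases lt_trichotomy s 0 with hs | rfl | hs
  · rw [abs_of_neg hs, abs_lt] at h
    rw [Int.sign_eq_neg_one_of_neg hs, Int.sign_eq_neg_one_of_neg (by omega)]
  · simp at h
    exact absurd h (abs_nonneg t).not_gt
  · rw [abs_of_pos hs, abs_lt] at h
    rw [Int.sign_eq_one_of_pos hs, Int.sign_eq_one_of_pos (by omega)]

lemma IsMunchhausen.exists_entry_ne_zero {k n : ℕ} (hn : n = 3 ^ k)
    {M : Matrix (Fin k) (Fin n) ℤ} (hM : IsMunchhausen M) (i : Fin k) : ∃ j, M i j ≠ 0 := by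
  have h : 0 < #{j | M i j ≠ 0} := by rw [hM.card_ne_zero hn i]; positivity
  obtain ⟨j, hj⟩ := card_pos.1 h
  exact ⟨j, (mem_filter.1 hj).2⟩

/-- A flipped row has the opposite weight. -/
lemma sum_mul_flip {k n : ℕ} {M : Matrix (Fin k) (Fin n) ℤ} {φ : Equiv.Perm (Fin n)}
    {i : Fin k} (hinv : ∀ j, φ (φ j) = j) (hφ : ∀ j, M i (φ j) = -M i j) :
    ∑ j, M i j * ((φ j : ℤ) + 1) = -rowWeight M i := by
  rw [← Equiv.sum_comp φ, rowWeight, ← Finset.sum_neg_distrib]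
  exact Finset.sum_congr rfl fun j _ => by rw [hinv, hφ, neg_mul]

lemma IsMunchhausen.rowWeight_ne_zero {k n : ℕ} (hn : n = 3 ^ k)
    {M : Matrix (Fin k) (Fin n) ℤ} (hM : IsMunchhausen M) (i : Fin k) :
    rowWeight M i ≠ 0 := by
  intro h0
  obtain ⟨φ, hinv, hφ, hφ'⟩ := hM.exists_flip hn i
  have hone : φ = 1 := hM.eq_one φ fun i' => by
    rcases eq_or_ne i' i with rfl | hi'
    · rw [sum_mul_flip hinv hφ, h0, neg_zero]
    · rw [← Equiv.sum_comp φ, rowWeight]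
      simp only [hinv, hφ' i' hi']
  obtain ⟨j, hj⟩ := hM.exists_entry_ne_zero hn i
  have := hφ j
  rw [hone, Equiv.Perm.one_apply] at this
  omega

lemma IsMunchhausen.le_abs_rowWeight {k n : ℕ} (hn : n = 3 ^ k)
    {M : Matrix (Fin k) (Fin n) ℤ} (hM : IsMunchhausen M) (i : Fin k) :
    3 ^ (k - 1) ≤ |rowWeight M i| := by
  obtain ⟨φ, hinv, hφ, hφ'⟩ := hM.exists_flip hn i
  set s := rowWeight M i with hs
  have hs0 : s ≠ 0 := hM.rowWeight_ne_zero hn i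
  have hpos : ∀ j, M i j ≠ 0 → 1 ≤ M i j * ((j : ℤ) - φ j) * s.sign := by
    intro j hj
    by_contra! hlt
    have hle : 0 ≤ M i j * ((φ j : ℤ) - j) * s := by
      rw [← Int.sign_mul_abs s]
      nlinarith [abs_nonneg s]
    have heq : j = φ j := hM.eq_of_swap j (φ j) fun i' => by
      rcases eq_or_ne i' i with rfl | hi'
      · refine Int.sign_add_of_mul_nonneg hs0 ?_
        rw [hφ]
        linarith
      · simp [hφ' i' hi']
    have := hφ j
    rw [← heq] at this
    omega
  have hsum : ∑ j, M i j * ((j : ℤ) - φ j) = 2 * s := by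
    have := sum_mul_flip hinv hφ
    calc ∑ j, M i j * ((j : ℤ) - φ j)
        = rowWeight M i - ∑ j, M i j * ((φ j : ℤ) + 1) := by
          rw [rowWeight, ← Finset.sum_sub_distrib]
          exact Finset.sum_congr rfl fun j _ => by ring
      _ = 2 * s := by rw [this]; ring
  have hcard : ((#{j | M i j ≠ 0} : ℕ) : ℤ) ≤ ∑ j, M i j * ((j : ℤ) - φ j) * s.sign := by
    rw [Finset.card_filter]
    push_cast
    refine Finset.sum_le_sum fun j _ => ?_
    split_ifs with hj
    · exact hpos j hj
    · rw [not_not.1 hj]; simp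
  rw [← Finset.sum_mul, hsum, hM.card_ne_zero hn i] at hcard
  have := Int.mul_sign_self s
  push_cast at hcard this
  linarith

theorem not_isMunchhausen_three_pow {k n : ℕ} (hk : 2 ≤ k) (hn : n = 3 ^ k)
    (M : Matrix (Fin k) (Fin n) ℤ) : ¬ IsMunchhausen M := by
  intro hM
  have hn1 : 1 < n := hn ▸ Nat.one_lt_pow (by omega) (by norm_num)
  have h3 : (3 : ℤ) ≤ 3 ^ (k - 1) := le_self_pow₀ (by norm_num) (by omega)
  have h01 : (⟨0, by omega⟩ : Fin n) = ⟨1, hn1⟩ := hM.eq_of_swap _ _ fun i => by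
    refine Int.sign_add_of_abs_lt (lt_of_lt_of_le ?_ (h3.trans (hM.le_abs_rowWeight hn i)))
    rcases hM.1 i ⟨0, by omega⟩ with h | h | h <;>
      rcases hM.1 i ⟨1, hn1⟩ with h' | h' | h' <;> simp [h, h']
  simp at h01

/-- There are infinitely many positive `n` with `B n ≠ ⌈log₃ n⌉`. -/
theorem infinitely_many_nontrivial :
    {n : ℕ | 0 < n ∧ (B n : ℤ) ≠ ⌈Real.logb 3 (n : ℝ)⌉}.Infinite := by
  refine Set.infinite_of_injective_forall_mem (f := fun m : ℕ => 3 ^ (m + 2))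
    (fun a b hab => by simpa using hab) fun m => ⟨by positivity, fun h => ?_⟩
  have hlog : Real.logb 3 ((3 ^ (m + 2) : ℕ) : ℝ) = ((m + 2 : ℕ) : ℝ) := by
    rw [Nat.cast_pow, Nat.cast_ofNat, Real.logb_pow, Real.logb_self_eq_one (by norm_num), mul_one]
  rw [hlog, Int.ceil_natCast] at h
  have hB : B (3 ^ (m + 2)) = m + 2 := by exact_mod_cast h
  have hmem : B (3 ^ (m + 2)) ∈
      {k : ℕ | ∃ M : Matrix (Fin k) (Fin (3 ^ (m + 2))) ℤ, IsMunchhausen M} :=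
    Nat.sInf_mem (Nat.nonempty_of_pos_sInf (lt_of_lt_of_eq (Nat.succ_pos (m + 1)) hB.symm))
  rw [hB] at hmem
  obtain ⟨M, hM⟩ := hmem
  exact not_isMunchhausen_three_pow (by omega) rfl M hM
end

section
/- The function N is unbounded: for every natural number m there exists a positive integer k such that N(k) ≥ m, where N(k) is the number of positive integers n with ⌈log₃ n⌉ = k and B(n) ≠ k. -/
/-- `N k` is the number of positive integers `n` with `⌈log₃ n⌉ = k` and `B n ≠ k`. -/
noncomputable def N (k : ℕ) : ℕ :=
  Nat.card {n : ℕ // 0 < n ∧ ⌈Real.logb 3 (n : ℝ)⌉ = (k : ℤ) ∧ B n ≠ k}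

theorem wvec_mul_permMatrix_s14 {k n : ℕ} (M : Matrix (Fin k) (Fin n) ℤ) (σ : Equiv.Perm (Fin n)) :
    wvec (M * σ.permMatrix ℤ) = wvec (M.submatrix id σ.symm) := by
  rw [Equiv.Perm.permMatrix, PEquiv.mul_toMatrix_toPEquiv]

/-- The columns of a Münchhausen matrix are pairwise distinct. -/
theorem IsMunchhausen.col_injective {k n : ℕ} {M : Matrix (Fin k) (Fin n) ℤ}
    (hM : IsMunchhausen M) : Function.Injective M.col := by
  intro a b hab
  have h := hM.2 (Equiv.swap a b) (by
    rw [wvec_mul_permMatrix_s14]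
    congr 1
    ext i j
    have hi : M i a = M i b := congrFun hab i
    simp only [Matrix.submatrix_apply, id, Equiv.symm_swap]
    rcases eq_or_ne j a with rfl | hja
    · rw [Equiv.swap_apply_left, hi]
    rcases eq_or_ne j b with rfl | hjb
    · rw [Equiv.swap_apply_right, hi]
    rw [Equiv.swap_apply_of_ne_of_ne hja hjb])
  exact Equiv.swap_eq_one_iff.mp h

/-- If swapping two rows with equal outcome permutes the columns of a Münchhausen matrix,
then the two rows coincide. -/
theorem IsMunchhausen.row_eq_of_swap {k n : ℕ} {M : Matrix (Fin k) (Fin n) ℤ}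
    (hM : IsMunchhausen M) {i i' : Fin k} (hw : wvec M i = wvec M i')
    (hcol : ∀ j, ∃ j', ∀ l, M l j' = M (Equiv.swap i i' l) j) (j : Fin n) :
    M i j = M i' j := by
  choose s hs using hcol
  have hinv : Function.Involutive s := fun j => hM.col_injective <| by
    ext l
    simp only [Matrix.col_apply, hs, Equiv.swap_apply_self]
  have h1 := hM.2 hinv.toPerm (by
    rw [wvec_mul_permMatrix_s14, hinv.toPerm_symm]
    have key : wvec (M.submatrix id hinv.toPerm) = fun l => wvec M (Equiv.swap i i' l) := by
      ext l
      simp [wvec, Matrix.mulVec, dotProduct, hs]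
    rw [key]
    ext l
    rcases eq_or_ne l i with rfl | hi
    · rw [Equiv.swap_apply_left, hw]
    rcases eq_or_ne l i' with rfl | hi'
    · rw [Equiv.swap_apply_right, hw]
    rw [Equiv.swap_apply_of_ne_of_ne hi hi'])
  have hj : s j = j := DFunLike.congr_fun h1 j
  have := hs j i
  rwa [hj, Equiv.swap_apply_left] at this

/-- A Münchhausen matrix omitting `r` of the `3 ^ k` possible columns has at most `3 ^ (r + 1)`
rows. -/
theorem IsMunchhausen.le_pow {k n r : ℕ} {M : Matrix (Fin k) (Fin n) ℤ}
    (hM : IsMunchhausen M) (hr : n + r = 3 ^ k) : k ≤ 3 ^ (r + 1) := by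
  classical
  by_contra! hk
  let T : Finset ℤ := {-1, 0, 1}
  let S : Finset (Fin k → ℤ) := Fintype.piFinset fun _ => T
  have hT : T.card = 3 := rfl
  have hMS : Finset.univ.image M.col ⊆ S := by
    intro c hc
    obtain ⟨j, -, rfl⟩ := Finset.mem_image.mp hc
    simpa [S, T] using fun i => hM.1 i j
  let D : Finset (Fin k → ℤ) := S \ Finset.univ.image M.col
  have hD : D.card = r := by
    rw [Finset.card_sdiff_of_subset hMS, Finset.card_image_of_injective _ hM.col_injective,
      Fintype.card_piFinset]
    simp [hT]
    omega
  have hwT : ∀ i, wvec M i ∈ T := fun i => by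
    rcases Int.sign_trichotomy (M.mulVec (coinVec n) i) with h | h | h <;> simp [T, wvec, h]
  let f : Fin k → (D → T) × T := fun i =>
    (fun d => ⟨d.1 i, Fintype.mem_piFinset.mp (Finset.mem_sdiff.mp d.2).1 i⟩, ⟨wvec M i, hwT i⟩)
  obtain ⟨i, i', hne, hf⟩ := Fintype.exists_ne_map_eq_of_card_lt f (by
    simpa [hD, hT, ← pow_succ] using hk)
  obtain ⟨hf₁, hf₂⟩ := Prod.ext_iff.mp hf
  have hw : wvec M i = wvec M i' := congrArg Subtype.val hf₂
  have hd : ∀ d ∈ D, d i = d i' := fun d h => congrArg Subtype.val (congrFun hf₁ ⟨d, h⟩)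
  have himg : ∀ c ∈ S, c ∉ D → ∃ j, M.col j = c := fun c hc hcD => by
    simpa [D, hc] using hcD
  have hrow := hM.row_eq_of_swap hw fun j => by
    have hjS : M.col j ∈ S := hMS (Finset.mem_image_of_mem _ (Finset.mem_univ j))
    have hnot : (fun l => M (Equiv.swap i i' l) j) ∉ D := fun h => by
      have hij : M i' j = M i j := by simpa using hd _ h
      have heq : (fun l => M (Equiv.swap i i' l) j) = M.col j := by
        ext l
        rcases eq_or_ne l i with rfl | hi
        · simpa using hij
        rcases eq_or_ne l i' with rfl | hi'
        · simpa using hij.symm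
        simp [Equiv.swap_apply_of_ne_of_ne hi hi']
      rw [heq] at h
      simp [D] at h
    obtain ⟨j', hj'⟩ := himg _ (Fintype.mem_piFinset.mpr fun l =>
      Fintype.mem_piFinset.mp hjS (Equiv.swap i i' l)) hnot
    exact ⟨j', congrFun hj'⟩
  have hsS : Pi.single i (1 : ℤ) ∈ S := by
    refine Fintype.mem_piFinset.mpr fun l => ?_
    by_cases h : l = i <;> simp [T, h]
  obtain ⟨j, hj⟩ := himg _ hsS fun h => by simpa [hne.symm] using hd _ h
  have h₁ : M i j = 1 := by simpa using congrFun hj i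
  have h₀ : M i' j = 0 := by simpa [hne.symm] using congrFun hj i'
  simpa [h₁, h₀] using hrow j

theorem B_ne_of_pow_lt {k n r : ℕ} (hr : n + r = 3 ^ k) (hk : 3 ^ (r + 1) < k) : B n ≠ k := by
  intro h
  have hne : {k : ℕ | ∃ M : Matrix (Fin k) (Fin n) ℤ, IsMunchhausen M}.Nonempty :=
    Nat.nonempty_of_pos_sInf (show 0 < B n from h ▸ (Nat.zero_le _).trans_lt hk)
  have hmem := Nat.sInf_mem hne
  change B n ∈ _ at hmem
  rw [h] at hmem
  obtain ⟨M, hM⟩ := hmem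
  exact hk.not_ge (hM.le_pow hr)

theorem ceil_logb_three_eq_succ {k n : ℕ} (h₁ : 3 ^ k < n) (h₂ : n ≤ 3 ^ (k + 1)) :
    ⌈Real.logb 3 (n : ℝ)⌉ = ((k + 1 : ℕ) : ℤ) := by
  have hn : (0 : ℝ) < n := by exact_mod_cast (Nat.zero_le _).trans_lt h₁
  rw [Int.ceil_eq_iff]
  constructor
  · rw [Real.lt_logb_iff_rpow_lt (by norm_num) hn]
    push_cast
    rw [add_sub_cancel_right, Real.rpow_natCast]
    exact_mod_cast h₁
  · rw [Real.logb_le_iff_le_rpow (by norm_num) hn, Int.cast_natCast, Real.rpow_natCast]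
    exact_mod_cast h₂

theorem finite_ceil_logb_three_eq (k : ℕ) :
    {n : ℕ | 0 < n ∧ ⌈Real.logb 3 (n : ℝ)⌉ = (k : ℤ) ∧ B n ≠ k}.Finite := by
  refine (Set.finite_Iic (3 ^ k)).subset ?_
  rintro n ⟨hn, hc, -⟩
  have h := (Int.ceil_eq_iff.mp hc).2
  rw [Real.logb_le_iff_le_rpow (by norm_num) (by exact_mod_cast hn), Int.cast_natCast,
    Real.rpow_natCast] at h
  exact Set.mem_Iic.mpr (by exact_mod_cast h)

/-- `N` is unbounded. -/
theorem N_unbounded : ∀ m : ℕ, ∃ k : ℕ, 0 < k ∧ m ≤ N k := by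
  intro m
  refine ⟨3 ^ (m + 1) + 1, Nat.succ_pos _, ?_⟩
  have hm : m < 3 ^ 3 ^ (m + 1) := calc
    m < m + 1 := Nat.lt_succ_self m
    _ < 3 ^ (m + 1) := Nat.lt_pow_self (by norm_num)
    _ < 3 ^ 3 ^ (m + 1) := Nat.lt_pow_self (by norm_num)
  have hpow : 3 ^ (3 ^ (m + 1) + 1) = 3 * 3 ^ 3 ^ (m + 1) := pow_succ' _ _
  have hmem : ∀ r : Fin m, 0 < 3 ^ (3 ^ (m + 1) + 1) - r.1 ∧
      ⌈Real.logb 3 ((3 ^ (3 ^ (m + 1) + 1) - r.1 : ℕ) : ℝ)⌉ = ((3 ^ (m + 1) + 1 : ℕ) : ℤ) ∧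
      B (3 ^ (3 ^ (m + 1) + 1) - r.1) ≠ 3 ^ (m + 1) + 1 := fun r => by
    have hrm := r.2
    refine ⟨by omega, ceil_logb_three_eq_succ (by omega) (Nat.sub_le _ _),
      B_ne_of_pow_lt (r := r.1) (by omega) (Nat.lt_succ_of_le ?_)⟩
    exact Nat.pow_le_pow_right (by norm_num) (by omega)
  have := (finite_ceil_logb_three_eq (3 ^ (m + 1) + 1)).to_subtype
  have hcard := Nat.card_le_card_of_injective
    (β := {n : ℕ | 0 < n ∧ ⌈Real.logb 3 (n : ℝ)⌉ = ((3 ^ (m + 1) + 1 : ℕ) : ℤ) ∧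
      B n ≠ 3 ^ (m + 1) + 1}) (fun r : Fin m => ⟨_, hmem r⟩) fun a b hab => by
    have h := congrArg Subtype.val hab
    have ha := a.2
    have hb := b.2
    ext
    dsimp only at h
    omega
  rwa [Nat.card_fin] at hcard
end
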